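/- Let K be a field of characteristic zero. For tuples a ∈ lie_ℓ^ℓ, b ∈ lie_m^m, c ∈ lie_n^n and 1 ≤ j ≤ ℓ, the following hold as equalities of tuples in (lie_{ℓ+m+n−2})^{ℓ+m+n−2}: (i) if 1 ≤ i ≤ j−1 then (a ∘_j b) ∘_i c = (a ∘_i c) ∘_{j+n−1} b; (ii) if j ≤ i ≤ j+m−1 then (a ∘_j b) ∘_i c = a ∘_j (b ∘_{i−j+1} c); (iii) if j+m ≤ i ≤ ℓ+m−1 then (a ∘_j b) ∘_i c = (a ∘_{i−m+1} c) ∘_j b. -/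

import Mathlib

open FreeLieAlgebra

variable (K : Type) [Field K] [CharZero K]

/-- The free Lie algebra over `K` on `N` generators `x_1, …, x_N`
(indexed here 0-based by `Fin N`). -/
abbrev lieF (N : ℕ) : Type := FreeLieAlgebra K (Fin N)

/-- The `(k+1)`-st generator of `lieF K N` (0-based index `k`), junk value `0` out of range. -/
noncomputable def xg (N k : ℕ) : lieF K N :=
  if h : k < N then FreeLieAlgebra.of K (⟨k, h⟩ : Fin N) else 0

/-- The Lie algebra homomorphism `Φ_i : lie_m → lie_{m+n-1}` sending (0-based) `x_j ↦ x_j`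
for `j < i`, `x_i ↦ x_i + x_{i+1} + ⋯ + x_{i+n-1}`, and `x_j ↦ x_{j+n-1}` for `j > i`. -/
noncomputable def PhiL (m n i : ℕ) : lieF K m →ₗ⁅K⁆ lieF K (m + n - 1) :=
  FreeLieAlgebra.lift K fun j : Fin m =>
    if (j : ℕ) < i then xg K (m + n - 1) (j : ℕ)
    else if (j : ℕ) = i then ∑ t : Fin n, xg K (m + n - 1) (i + (t : ℕ))
    else xg K (m + n - 1) ((j : ℕ) + n - 1)

/-- The Lie algebra homomorphism `Ψ_i : lie_n → lie_{m+n-1}` sending (0-based)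
`x_j ↦ x_{i+j}`. -/
noncomputable def PsiL (m n i : ℕ) : lieF K n →ₗ⁅K⁆ lieF K (m + n - 1) :=
  FreeLieAlgebra.lift K fun j : Fin n => xg K (m + n - 1) (i + (j : ℕ))

/-- The partial composition `f ∘_i g := Φ_i(f) + Ψ_i(g)` of free Lie algebra elements
(the pivot `i` is 0-based). -/
noncomputable def compL {m n : ℕ} (f : lieF K m) (i : ℕ) (g : lieF K n) :
    lieF K (m + n - 1) :=
  PhiL K m n i f + PsiL K m n i g

/-- The canonical identification `lie_N ≅ lie_{N'}` for `N = N'`. -/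
noncomputable def recastL {N N' : ℕ} (hNN : N = N') : lieF K N →ₗ⁅K⁆ lieF K N' :=
  FreeLieAlgebra.lift K fun j => FreeLieAlgebra.of K (Fin.cast hNN j)

/-- Entry of a tuple at a natural-number index (junk value `0` out of range). -/
noncomputable def tget {N : ℕ} (a : Fin N → lieF K N) (k : ℕ) : lieF K N :=
  if h : k < N then a ⟨k, h⟩ else 0

/-- The composed tuple `a ∘_i b ∈ (lie_{m+n-1})^{m+n-1}` (0-based indices): its entries are
`Φ_i(a_j)` in slot `j` for `j < i`, `Φ_i(a_i) + Ψ_i(b_k)` in slot `i+k` for `0 ≤ k < n`,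
and `Φ_i(a_j)` in slot `j+n-1` for `j > i`. -/
noncomputable def compTup {m n : ℕ} (a : Fin m → lieF K m) (i : ℕ)
    (b : Fin n → lieF K n) : Fin (m + n - 1) → lieF K (m + n - 1) := fun k =>
  if (k : ℕ) < i then PhiL K m n i (tget K a (k : ℕ))
  else if (k : ℕ) < i + n then
    PhiL K m n i (tget K a i) + PsiL K m n i (tget K b ((k : ℕ) - i))
  else PhiL K m n i (tget K a ((k : ℕ) + 1 - n))

/-- The canonical identification of tuples over `lie_N` and over `lie_{N'}` for `N = N'`. -/
noncomputable def recastTup {N N' : ℕ} (hNN : N = N') (a : Fin N → lieF K N) :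
    Fin N' → lieF K N' := fun k => recastL K hNN (a (Fin.cast hNN.symm k))

section FreeLieTuples

set_option linter.unusedSectionVars false

theorem of_eq_xg {N : ℕ} (x : Fin N) : FreeLieAlgebra.of K x = xg K N x := by
  simp [xg]

theorem recastL_xg {N N' : ℕ} (h : N = N') (k : ℕ) :
    recastL K h (xg K N k) = xg K N' k := by
  subst h
  unfold xg
  split <;> simp [recastL]

theorem recastL_recastL {N N' : ℕ} (h : N = N') (f : lieF K N) :
    recastL K h.symm (recastL K h f) = f := by
  have : (recastL K h.symm).comp (recastL K h) = LieHom.id := by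
    ext x
    rw [of_eq_xg, LieHom.comp_apply, recastL_xg, recastL_xg, LieHom.id_apply]
  exact LieHom.congr_fun this f

theorem PhiL_xg_of_lt {m n i k : ℕ} (hk : k < m) (h : k < i) :
    PhiL K m n i (xg K m k) = xg K (m + n - 1) k := by
  simp [PhiL, xg, hk, h]

theorem PhiL_xg_self {m n i : ℕ} (hi : i < m) :
    PhiL K m n i (xg K m i) = ∑ t ∈ Finset.range n, xg K (m + n - 1) (i + t) := by
  rw [Finset.sum_range]
  simp only [PhiL, xg, hi, dite_true, FreeLieAlgebra.lift_of_apply, lt_irrefl, if_false, if_true]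

theorem PhiL_xg_of_gt {m n i k : ℕ} (hk : k < m) (h : i < k) :
    PhiL K m n i (xg K m k) = xg K (m + n - 1) (k + n - 1) := by
  simp only [PhiL, xg, hk, dite_true, FreeLieAlgebra.lift_of_apply, h.not_gt, h.ne', if_false]

theorem PsiL_xg {m n i k : ℕ} (hk : k < n) :
    PsiL K m n i (xg K n k) = xg K (m + n - 1) (i + k) := by
  simp [PsiL, xg, hk]

theorem lieHom_map_sum_range {M N : ℕ} (φ : lieF K M →ₗ⁅K⁆ lieF K N) (n : ℕ) (f : ℕ → lieF K M) :
    φ (∑ t ∈ Finset.range n, f t) = ∑ t ∈ Finset.range n, φ (f t) :=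
  map_sum φ f _

theorem PhiL_PhiL_of_lt {ℓ m n i j : ℕ} (hj : j < ℓ) (hm : 1 ≤ m) (hn : 1 ≤ n) (hij : i < j)
    (h : ℓ + n - 1 + m - 1 = ℓ + m - 1 + n - 1) (f : lieF K ℓ) :
    PhiL K (ℓ + m - 1) n i (PhiL K ℓ m j f) =
      recastL K h (PhiL K (ℓ + n - 1) m (j + n - 1) (PhiL K ℓ n i f)) := by
  suffices (PhiL K (ℓ + m - 1) n i).comp (PhiL K ℓ m j) = (recastL K h).comp
      ((PhiL K (ℓ + n - 1) m (j + n - 1)).comp (PhiL K ℓ n i)) from LieHom.congr_fun this f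
  ext ⟨k, hk⟩
  rw [of_eq_xg]
  simp only [LieHom.comp_apply]
  rcases lt_trichotomy k i with h1 | rfl | h1
  · rw [PhiL_xg_of_lt K hk (by omega), PhiL_xg_of_lt K (by omega) h1, PhiL_xg_of_lt K hk h1,
      PhiL_xg_of_lt K (by omega) (by omega), recastL_xg]
  · rw [PhiL_xg_of_lt K hk hij, PhiL_xg_self K (by omega), PhiL_xg_self K hk, lieHom_map_sum_range,
      lieHom_map_sum_range]
    refine Finset.sum_congr rfl fun t ht => ?_
    rw [Finset.mem_range] at ht
    rw [PhiL_xg_of_lt K (by omega) (by omega), recastL_xg]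
  · rw [PhiL_xg_of_gt K hk h1]
    rcases lt_trichotomy k j with h2 | rfl | h2
    · rw [PhiL_xg_of_lt K hk h2, PhiL_xg_of_gt K (by omega) h1,
        PhiL_xg_of_lt K (by omega) (by omega), recastL_xg]
    · rw [PhiL_xg_self K hk, PhiL_xg_self K (by omega), lieHom_map_sum_range, lieHom_map_sum_range]
      refine Finset.sum_congr rfl fun t ht => ?_
      rw [Finset.mem_range] at ht
      rw [PhiL_xg_of_gt K (by omega) (by omega), recastL_xg]
      congr 1; omega
    · rw [PhiL_xg_of_gt K hk h2, PhiL_xg_of_gt K (by omega) (by omega),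
        PhiL_xg_of_gt K (by omega) (by omega), recastL_xg]
      congr 1; omega

theorem PhiL_PsiL_of_lt {ℓ m n i j : ℕ} (hj : j < ℓ) (hn : 1 ≤ n) (hij : i < j)
    (h : ℓ + n - 1 + m - 1 = ℓ + m - 1 + n - 1) (f : lieF K m) :
    PhiL K (ℓ + m - 1) n i (PsiL K ℓ m j f) =
      recastL K h (PsiL K (ℓ + n - 1) m (j + n - 1) f) := by
  suffices (PhiL K (ℓ + m - 1) n i).comp (PsiL K ℓ m j) = (recastL K h).comp
      (PsiL K (ℓ + n - 1) m (j + n - 1)) from LieHom.congr_fun this f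
  ext ⟨k, hk⟩
  rw [of_eq_xg]
  simp only [LieHom.comp_apply]
  rw [PsiL_xg K hk, PsiL_xg K hk, PhiL_xg_of_gt K (by omega) (by omega), recastL_xg]
  congr 1; omega

theorem recastL_PhiL_PsiL_of_lt {ℓ m n i j : ℕ} (hj : j < ℓ) (hij : i < j)
    (h : ℓ + n - 1 + m - 1 = ℓ + m - 1 + n - 1) (f : lieF K n) :
    recastL K h (PhiL K (ℓ + n - 1) m (j + n - 1) (PsiL K ℓ n i f)) =
      PsiL K (ℓ + m - 1) n i f := by
  suffices (recastL K h).comp ((PhiL K (ℓ + n - 1) m (j + n - 1)).comp (PsiL K ℓ n i)) =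
      PsiL K (ℓ + m - 1) n i from LieHom.congr_fun this f
  ext ⟨k, hk⟩
  rw [of_eq_xg]
  simp only [LieHom.comp_apply]
  rw [PsiL_xg K hk, PsiL_xg K hk, PhiL_xg_of_lt K (by omega) (by omega), recastL_xg]

theorem PhiL_PhiL_of_mem {ℓ m n i j : ℕ} (hj : j < ℓ) (hn : 1 ≤ n) (hji : j ≤ i)
    (hij : i < j + m) (h : ℓ + (m + n - 1) - 1 = ℓ + m - 1 + n - 1) (f : lieF K ℓ) :
    PhiL K (ℓ + m - 1) n i (PhiL K ℓ m j f) = recastL K h (PhiL K ℓ (m + n - 1) j f) := by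
  suffices (PhiL K (ℓ + m - 1) n i).comp (PhiL K ℓ m j) = (recastL K h).comp
      (PhiL K ℓ (m + n - 1) j) from LieHom.congr_fun this f
  ext ⟨k, hk⟩
  rw [of_eq_xg]
  simp only [LieHom.comp_apply]
  rcases lt_trichotomy k j with h1 | rfl | h1
  · rw [PhiL_xg_of_lt K hk h1, PhiL_xg_of_lt K hk h1, PhiL_xg_of_lt K (by omega) (by omega),
      recastL_xg]
  · rw [PhiL_xg_self K hk, PhiL_xg_self K hk, lieHom_map_sum_range, lieHom_map_sum_range]
    simp only [recastL_xg]
    obtain ⟨p, rfl⟩ := Nat.exists_eq_add_of_le hji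
    obtain ⟨q, rfl⟩ : ∃ q, m = p + 1 + q := ⟨m - p - 1, by omega⟩
    rw [show p + 1 + q + n - 1 = p + n + q by omega, Finset.sum_range_add, Finset.sum_range_succ,
      Finset.sum_range_add _ (p + n), Finset.sum_range_add, PhiL_xg_self K (by omega)]
    congr 1
    · congr 1
      · refine Finset.sum_congr rfl fun t ht => ?_
        rw [Finset.mem_range] at ht
        rw [PhiL_xg_of_lt K (by omega) (by omega)]
      · simp only [add_assoc]
    · refine Finset.sum_congr rfl fun t ht => ?_
      rw [Finset.mem_range] at ht
      rw [PhiL_xg_of_gt K (by omega) (by omega)]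
      congr 1; omega
  · rw [PhiL_xg_of_gt K hk h1, PhiL_xg_of_gt K hk h1, PhiL_xg_of_gt K (by omega) (by omega),
      recastL_xg]
    congr 1; omega

theorem PhiL_PsiL_of_mem {ℓ m n i j : ℕ} (hj : j < ℓ) (hn : 1 ≤ n) (hji : j ≤ i)
    (hij : i < j + m) (h : ℓ + (m + n - 1) - 1 = ℓ + m - 1 + n - 1) (f : lieF K m) :
    PhiL K (ℓ + m - 1) n i (PsiL K ℓ m j f) =
      recastL K h (PsiL K ℓ (m + n - 1) j (PhiL K m n (i - j) f)) := by
  suffices (PhiL K (ℓ + m - 1) n i).comp (PsiL K ℓ m j) = (recastL K h).comp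
      ((PsiL K ℓ (m + n - 1) j).comp (PhiL K m n (i - j))) from LieHom.congr_fun this f
  obtain ⟨p, rfl⟩ := Nat.exists_eq_add_of_le hji
  rw [Nat.add_sub_cancel_left]
  ext ⟨k, hk⟩
  rw [of_eq_xg]
  simp only [LieHom.comp_apply]
  rw [PsiL_xg K hk]
  rcases lt_trichotomy k p with h1 | rfl | h1
  · rw [PhiL_xg_of_lt K (by omega) (by omega), PhiL_xg_of_lt K hk h1, PsiL_xg K (by omega),
      recastL_xg]
  · rw [PhiL_xg_self K (by omega), PhiL_xg_self K hk, lieHom_map_sum_range, lieHom_map_sum_range]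
    refine Finset.sum_congr rfl fun t ht => ?_
    rw [Finset.mem_range] at ht
    rw [PsiL_xg K (by omega), recastL_xg, add_assoc]
  · rw [PhiL_xg_of_gt K (by omega) (by omega), PhiL_xg_of_gt K hk h1, PsiL_xg K (by omega),
      recastL_xg]
    congr 1; omega

theorem recastL_PsiL_PsiL {ℓ m n i j : ℕ} (hji : j ≤ i) (hij : i < j + m)
    (h : ℓ + (m + n - 1) - 1 = ℓ + m - 1 + n - 1) (f : lieF K n) :
    recastL K h (PsiL K ℓ (m + n - 1) j (PsiL K m n (i - j) f)) =
      PsiL K (ℓ + m - 1) n i f := by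
  suffices (recastL K h).comp ((PsiL K ℓ (m + n - 1) j).comp (PsiL K m n (i - j))) =
      PsiL K (ℓ + m - 1) n i from LieHom.congr_fun this f
  ext ⟨k, hk⟩
  rw [of_eq_xg]
  simp only [LieHom.comp_apply]
  rw [PsiL_xg K hk, PsiL_xg K hk, PsiL_xg K (by omega), recastL_xg]
  congr 1; omega

theorem tget_compTup_of_lt {m n i k : ℕ} (a : Fin m → lieF K m) (b : Fin n → lieF K n)
    (hk : k < m + n - 1) (h : k < i) :
    tget K (compTup K a i b) k = PhiL K m n i (tget K a k) := by
  rw [tget, dif_pos hk, compTup, if_pos h]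

theorem tget_compTup_of_mem {m n i k : ℕ} (a : Fin m → lieF K m) (b : Fin n → lieF K n)
    (hk : k < m + n - 1) (h : i ≤ k) (h' : k < i + n) :
    tget K (compTup K a i b) k =
      PhiL K m n i (tget K a i) + PsiL K m n i (tget K b (k - i)) := by
  rw [tget, dif_pos hk, compTup, if_neg h.not_gt, if_pos h']

theorem tget_compTup_of_ge {m n i k : ℕ} (a : Fin m → lieF K m) (b : Fin n → lieF K n)
    (hk : k < m + n - 1) (h : i + n ≤ k) :
    tget K (compTup K a i b) k = PhiL K m n i (tget K a (k + 1 - n)) := by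
  rw [tget, dif_pos hk, compTup, if_neg ((Nat.le_add_right i n).trans h).not_gt, if_neg h.not_gt]

theorem tget_recastTup {N N' : ℕ} (h : N = N') (a : Fin N → lieF K N) (k : ℕ) :
    tget K (recastTup K h a) k = recastL K h (tget K a k) := by
  subst h
  unfold tget
  split <;> simp [recastTup]

theorem tuple_ext {N : ℕ} {a b : Fin N → lieF K N} (h : ∀ k < N, tget K a k = tget K b k) :
    a = b := by
  funext k
  simpa [tget] using h k k.2

theorem recastTup_recastTup {N N' : ℕ} (h : N = N') (a : Fin N → lieF K N) :
    recastTup K h.symm (recastTup K h a) = a := by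
  funext k
  exact recastL_recastL K h (a k)

theorem compTup_compTup_of_lt {ℓ m n i j : ℕ} (hm : 1 ≤ m) (hn : 1 ≤ n)
    (a : Fin ℓ → lieF K ℓ) (b : Fin m → lieF K m) (c : Fin n → lieF K n)
    (hj : j < ℓ) (hij : i < j) (h : ℓ + n - 1 + m - 1 = ℓ + m - 1 + n - 1) :
    compTup K (compTup K a j b) i c =
      recastTup K h (compTup K (compTup K a i c) (j + n - 1) b) := by
  refine tuple_ext K fun k hk => ?_
  rw [tget_recastTup]
  rcases lt_or_ge k i with h1 | h1
  · rw [tget_compTup_of_lt K _ _ hk h1, tget_compTup_of_lt K _ _ (by omega) (by omega),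
      tget_compTup_of_lt K _ _ (by omega) (by omega), tget_compTup_of_lt K _ _ (by omega) h1,
      PhiL_PhiL_of_lt K hj hm hn hij h]
  rcases lt_or_ge k (i + n) with h2 | h2
  · rw [tget_compTup_of_mem K _ _ hk h1 h2, tget_compTup_of_lt K _ _ (by omega) hij,
      tget_compTup_of_lt K _ _ (by omega) (by omega),
      tget_compTup_of_mem K _ _ (by omega) h1 h2, map_add, map_add,
      PhiL_PhiL_of_lt K hj hm hn hij h, recastL_PhiL_PsiL_of_lt K hj hij h]
  rw [tget_compTup_of_ge K _ _ hk h2]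
  rcases lt_or_ge k (j + n - 1) with h3 | h3
  · rw [tget_compTup_of_lt K _ _ (by omega) (by omega),
      tget_compTup_of_lt K _ _ (by omega) h3, tget_compTup_of_ge K _ _ (by omega) h2,
      PhiL_PhiL_of_lt K hj hm hn hij h]
  rcases lt_or_ge k (j + n - 1 + m) with h4 | h4
  · rw [tget_compTup_of_mem K _ _ (by omega) (by omega) (by omega),
      tget_compTup_of_mem K _ _ (by omega) h3 h4,
      tget_compTup_of_ge K _ _ (by omega) (by omega), map_add, map_add,
      PhiL_PhiL_of_lt K hj hm hn hij h, PhiL_PsiL_of_lt K hj hn hij h,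
      show j + n - 1 + 1 - n = j by omega, show k + 1 - n - j = k - (j + n - 1) by omega]
  · rw [tget_compTup_of_ge K _ _ (by omega) (by omega), tget_compTup_of_ge K _ _ (by omega) h4,
      tget_compTup_of_ge K _ _ (by omega) (by omega), PhiL_PhiL_of_lt K hj hm hn hij h,
      show k + 1 - n + 1 - m = k + 1 - m + 1 - n by omega]

theorem compTup_compTup_of_mem {ℓ m n i j : ℕ} (hn : 1 ≤ n)
    (a : Fin ℓ → lieF K ℓ) (b : Fin m → lieF K m) (c : Fin n → lieF K n)
    (hj : j < ℓ) (hji : j ≤ i) (hij : i < j + m)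
    (h : ℓ + (m + n - 1) - 1 = ℓ + m - 1 + n - 1) :
    compTup K (compTup K a j b) i c =
      recastTup K h (compTup K a j (compTup K b (i - j) c)) := by
  refine tuple_ext K fun k hk => ?_
  rw [tget_recastTup]
  rcases lt_or_ge k j with h1 | h1
  · rw [tget_compTup_of_lt K _ _ hk (by omega), tget_compTup_of_lt K _ _ (by omega) h1,
      tget_compTup_of_lt K _ _ (by omega) h1, PhiL_PhiL_of_mem K hj hn hji hij h]
  rcases lt_or_ge k (j + (m + n - 1)) with h2 | h2
  · rw [tget_compTup_of_mem K a _ (by omega) h1 h2, map_add]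
    rcases lt_or_ge k i with h3 | h3
    · rw [tget_compTup_of_lt K _ _ hk h3, tget_compTup_of_mem K _ _ (by omega) h1 (by omega),
        tget_compTup_of_lt K _ _ (by omega) (by omega), map_add,
        PhiL_PhiL_of_mem K hj hn hji hij h, PhiL_PsiL_of_mem K hj hn hji hij h]
    rcases lt_or_ge k (i + n) with h4 | h4
    · rw [tget_compTup_of_mem K _ _ hk h3 h4, tget_compTup_of_mem K _ _ (by omega) hji hij,
        tget_compTup_of_mem K _ _ (by omega) (by omega) (by omega), map_add, map_add, map_add,
        PhiL_PhiL_of_mem K hj hn hji hij h, PhiL_PsiL_of_mem K hj hn hji hij h,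
        recastL_PsiL_PsiL K hji hij h, add_assoc, show k - j - (i - j) = k - i by omega]
    · rw [tget_compTup_of_ge K _ _ hk h4,
        tget_compTup_of_mem K _ _ (by omega) (by omega) (by omega),
        tget_compTup_of_ge K _ _ (by omega) (by omega), map_add,
        PhiL_PhiL_of_mem K hj hn hji hij h, PhiL_PsiL_of_mem K hj hn hji hij h,
        show k + 1 - n - j = k - j + 1 - n by omega]
  · rw [tget_compTup_of_ge K _ _ hk (by omega), tget_compTup_of_ge K _ _ (by omega) (by omega),
      tget_compTup_of_ge K _ _ (by omega) h2, PhiL_PhiL_of_mem K hj hn hji hij h,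
      show k + 1 - n + 1 - m = k + 1 - (m + n - 1) by omega]

end FreeLieTuples

/-- Associativity of the partial composition of tuples of free Lie algebra elements
(all indices 0-based, as in `lie_comp_assoc`). -/
theorem tuple_comp_assoc (ℓ m n : ℕ) (hℓ : 1 ≤ ℓ) (hm : 1 ≤ m) (hn : 1 ≤ n)
    (a : Fin ℓ → lieF K ℓ) (b : Fin m → lieF K m) (c : Fin n → lieF K n)
    (j : ℕ) (hj : j < ℓ) :
    (∀ i : ℕ, i < j →
      compTup K (compTup K a j b) i c =
        recastTup K (show ℓ + n - 1 + m - 1 = ℓ + m - 1 + n - 1 by omega)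
          (compTup K (compTup K a i c) (j + n - 1) b)) ∧
    (∀ i : ℕ, j ≤ i → i ≤ j + m - 1 →
      compTup K (compTup K a j b) i c =
        recastTup K (show ℓ + (m + n - 1) - 1 = ℓ + m - 1 + n - 1 by omega)
          (compTup K a j (compTup K b (i - j) c))) ∧
    (∀ i : ℕ, j + m ≤ i → i < ℓ + m - 1 →
      compTup K (compTup K a j b) i c =
        recastTup K (show ℓ + n - 1 + m - 1 = ℓ + m - 1 + n - 1 by omega)
          (compTup K (compTup K a (i + 1 - m) c) j b)) := by
  refine ⟨fun i hi => compTup_compTup_of_lt K hm hn a b c hj hi _,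
    fun i h1 h2 => compTup_compTup_of_mem K hn a b c hj h1 (by omega) _, fun i h1 h2 => ?_⟩
  obtain ⟨p, rfl⟩ : ∃ p, i = p + m - 1 := ⟨i + 1 - m, by omega⟩
  rw [show p + m - 1 + 1 - m = p by omega,
    compTup_compTup_of_lt K hn hm a c b (by omega) (by omega) (by omega), recastTup_recastTup]
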